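/- The family of graph pigeonhole principle formulas is simple: there is a sequence F = (F_n : n ∈ ℕ) of families of n-variate Boolean functions with |F_n| ≤ 2^{O(n·log n)} such that for every n, every graph pigeonhole formula PHP(G) over n variables has a tree-like sem(F) refutation of length polynomial in the size of PHP(G). -/

import Mathlib

/-- A Boolean function on `N` variables, viewed as the indicator of the set of
assignments it rules out. -/
abbrev BFunc (N : ℕ) := (Fin N → Bool) → Bool

/-- A clause over `N` Boolean variables: a disjunction of literals over distinct
variables, recorded by the polarity (if any) of each variable. -/
abbrev Clause (N : ℕ) := Fin N → Option Bool

/-- The assignment `α` satisfies the clause `c`. -/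
def clauseSat {N : ℕ} (c : Clause N) (α : Fin N → Bool) : Prop :=
  ∃ i b, c i = some b ∧ α i = b

/-- The indicator of the falsifying assignments of the clause `c`. -/
def falsInd {N : ℕ} (c : Clause N) : BFunc N :=
  fun α => decide (∀ i b, c i = some b → α i ≠ b)

/-- A tree-like semantic proof: a tree each of whose nodes is labelled with a Boolean
function and has at most two children. -/
inductive SemProof (N : ℕ) : Type
  | leaf : BFunc N → SemProof N
  | node1 : BFunc N → SemProof N → SemProof N
  | node2 : BFunc N → SemProof N → SemProof N → SemProof N

namespace SemProof

/-- The function labelling the root. -/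
def root {N : ℕ} : SemProof N → BFunc N
  | leaf f => f
  | node1 f _ => f
  | node2 f _ _ => f

/-- The length of a tree-like proof: its number of lines. -/
def length {N : ℕ} : SemProof N → ℕ
  | leaf _ => 1
  | node1 _ s => s.length + 1
  | node2 _ s t => s.length + t.length + 1

/-- A valid tree-like `sem(F)` derivation from the CNF formula `A`: every line either is
the indicator of the falsifying assignments of a clause of `A`, or belongs to `F` and is
semantically implied by its (at most two) premises. -/
def Valid {N : ℕ} (F : Set (BFunc N)) (A : Finset (Clause N)) : SemProof N → Prop
  | leaf f => ∃ c ∈ A, f = falsInd c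
  | node1 f s => ((∃ c ∈ A, f = falsInd c) ∨
      (f ∈ F ∧ ∀ α, f α = true → s.root α = true)) ∧ Valid F A s
  | node2 f s t => ((∃ c ∈ A, f = falsInd c) ∨
      (f ∈ F ∧ ∀ α, f α = true → s.root α = true ∨ t.root α = true)) ∧
      Valid F A s ∧ Valid F A t

end SemProof

/-- A tree-like `sem(F)` refutation of `A`: a valid derivation whose final line is the
constant-`1` function (ruling out every assignment, i.e. contradiction). -/
def IsRefutation {N : ℕ} (F : Set (BFunc N)) (A : Finset (Clause N)) (π : SemProof N) : Prop :=
  SemProof.Valid F A π ∧ ∀ α, π.root α = true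

/-- A tree-like `sem(F)` derivation of the function `g` from `A`. -/
def IsDerivation {N : ℕ} (F : Set (BFunc N)) (A : Finset (Clause N)) (π : SemProof N)
    (g : BFunc N) : Prop :=
  SemProof.Valid F A π ∧ π.root = g


open Classical in
/-- The graph pigeonhole CNF formula `PHP(G)` for the bipartite graph on pigeons
`Fin (m+1)` and holes `Fin m` with edge set `E`, whose variables `Fin N` name the edges
via the bijection `idx`.  It consists of the pigeon axioms `∨_{h ∈ N(p)} x_{p,h}` and
the hole axioms `¬x_{p,h} ∨ ¬x_{p',h}`. -/
noncomputable def phpCNF (m N : ℕ) (E : Finset (Fin (m + 1) × Fin m))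
    (idx : {e : Fin (m + 1) × Fin m // e ∈ E} → Fin N) : Finset (Clause N) :=
  (Finset.univ.image fun p : Fin (m + 1) =>
      (fun v => if ∃ e : {e // e ∈ E}, (e : Fin (m + 1) × Fin m).1 = p ∧ idx e = v
        then some true else none : Clause N)) ∪
  ((Finset.univ.filter fun q : Fin (m + 1) × Fin (m + 1) × Fin m =>
      q.1 ≠ q.2.1 ∧ (q.1, q.2.2) ∈ E ∧ (q.2.1, q.2.2) ∈ E).image
    fun q => (fun v => if ∃ e : {e // e ∈ E},
        idx e = v ∧ ((e : Fin (m + 1) × Fin m) = (q.1, q.2.2) ∨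
          (e : Fin (m + 1) × Fin m) = (q.2.1, q.2.2))
      then some false else none : Clause N))

/-- The disjunction of the indicators of a list of clauses. -/
def orL {N : ℕ} (L : List (Clause N)) : BFunc N := fun α => L.any (fun c => falsInd c α)

/-- Combine a nonempty list of axioms one by one. -/
lemma exists_orL_proof {N : ℕ} (F : Set (BFunc N)) (A : Finset (Clause N)) :
    ∀ L : List (Clause N), L ≠ [] → (∀ c ∈ L, c ∈ A) →
      (∀ k < L.length, orL (L.drop k) ∈ F) →
      ∃ π : SemProof N, π.Valid F A ∧ π.root = orL L ∧ π.length ≤ 2 * L.length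
  | [], h, _, _ => absurd rfl h
  | [c], _, hA, _ => by
      refine ⟨.leaf (falsInd c), ⟨c, hA c (by simp), rfl⟩, ?_, ?_⟩
      · funext α; simp [orL, SemProof.root]
      · simp [SemProof.length]
  | c :: d :: L, _, hA, hF => by
      obtain ⟨π, h1, h2, h3⟩ := exists_orL_proof F A (d :: L) (by simp)
        (fun x hx => hA x (List.mem_cons_of_mem _ hx))
        (fun k hk => by
          have := hF (k + 1) (by simpa using hk)
          simpa using this)
      refine ⟨.node2 (orL (c :: d :: L)) (.leaf (falsInd c)) π, ?_, rfl, ?_⟩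
      · refine ⟨Or.inr ⟨by simpa using hF 0 (by simp), ?_⟩, ⟨c, hA c (by simp), rfl⟩, h1⟩
        intro α hα
        rw [h2]
        simpa [orL, SemProof.root] using hα
      · simp only [SemProof.length, List.length_cons] at *
        omega

open Classical in
/-- The pigeonhole formula described by the labelling of variables by edges. -/
noncomputable def psi (m N : ℕ) (r : Fin N → Fin (m + 1) × Fin m) : Finset (Clause N) :=
  (Finset.univ.image fun p : Fin (m + 1) =>
      (fun v => if (r v).1 = p then some true else none : Clause N)) ∪
  ((Finset.univ.filter fun q : Fin (m + 1) × Fin (m + 1) × Fin m =>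
      q.1 ≠ q.2.1 ∧ (q.1, q.2.2) ∈ Set.range r ∧ (q.2.1, q.2.2) ∈ Set.range r).image
    fun q => (fun v => if r v = (q.1, q.2.2) ∨ r v = (q.2.1, q.2.2)
      then some false else none : Clause N))

lemma php_eq_psi (m N : ℕ) (E : Finset (Fin (m + 1) × Fin m))
    (e : {e : Fin (m + 1) × Fin m // e ∈ E} ≃ Fin N) :
    phpCNF m N E e = psi m N (fun v => (e.symm v : Fin (m + 1) × Fin m)) := by
  classical
  have hr : ∀ x, x ∈ Set.range (fun v => (e.symm v : Fin (m + 1) × Fin m)) ↔ x ∈ E := by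
    intro x
    constructor
    · rintro ⟨v, rfl⟩; exact (e.symm v).2
    · intro hx; exact ⟨e ⟨x, hx⟩, by simp⟩
  have h1 : ∀ (P : Fin (m + 1) × Fin m → Prop) (v : Fin N),
      (∃ a : {a // a ∈ E}, P a ∧ e a = v) ↔ P (e.symm v) := by
    intro P v
    constructor
    · rintro ⟨a, ha, rfl⟩; simpa using ha
    · intro h; exact ⟨e.symm v, h, by simp⟩
  have h2 : ∀ (P : Fin (m + 1) × Fin m → Prop) (v : Fin N),
      (∃ a : {a // a ∈ E}, e a = v ∧ P a) ↔ P (e.symm v) := by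
    intro P v
    rw [← h1 P v]; simp only [and_comm]
  unfold phpCNF psi
  congr 1
  · congr 1
    funext p v
    have := h1 (fun x => x.1 = p) v
    simp only [this]
  · congr 1
    · funext q v
      have := h2 (fun x => x = (q.1, q.2.2) ∨ x = (q.2.1, q.2.2)) v
      simp only [this]
    · ext q
      simp only [Finset.mem_filter, hr]

lemma psi_unsat (m N : ℕ) (r : Fin N → Fin (m + 1) × Fin m) (hr : Function.Injective r)
    (α : Fin N → Bool) : ∃ c ∈ psi m N r, falsInd c α = true := by
  classical
  by_contra! hcon
  have hv : ∀ p : Fin (m + 1), ∃ v, (r v).1 = p ∧ α v = true := by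
    intro p
    by_contra! h
    refine hcon (fun v => if (r v).1 = p then some true else none) ?_ ?_
    · unfold psi
      exact Finset.mem_union_left _ (Finset.mem_image.2 ⟨p, Finset.mem_univ _, rfl⟩)
    · simp only [falsInd, decide_eq_true_eq]
      intro i b hb
      split_ifs at hb with hi
      · cases hb; exact h i hi
  choose v hv1 hv2 using hv
  obtain ⟨p, p', hne, hpp⟩ := Fintype.exists_ne_map_eq_of_card_lt
    (fun p => (r (v p)).2) (by simp)
  have e1 : r (v p) = (p, (r (v p)).2) := Prod.ext (hv1 p) rfl
  have e2 : r (v p') = (p', (r (v p)).2) := Prod.ext (hv1 p') hpp.symm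
  refine hcon (fun w => if r w = (p, (r (v p)).2) ∨ r w = (p', (r (v p)).2)
    then some false else none) ?_ ?_
  · unfold psi
    refine Finset.mem_union_right _ (Finset.mem_image.2 ⟨(p, p', (r (v p)).2), ?_, rfl⟩)
    simp only [Finset.mem_filter, Finset.mem_univ, true_and]
    exact ⟨hne, ⟨_, e1⟩, ⟨_, e2⟩⟩
  · simp only [falsInd, decide_eq_true_eq]
    intro i b hb
    split_ifs at hb with hi
    cases hb
    rcases hi with hi | hi
    · rw [← e1] at hi
      rw [hr hi, hv2]; simp
    · rw [← e2] at hi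
      rw [hr hi, hv2]; simp

lemma psi_card (m N : ℕ) (hm : m < N) (r : Fin N → Fin (m + 1) × Fin m) :
    (psi m N r).card ≤ N + N ^ 3 := by
  classical
  unfold psi
  refine (Finset.card_union_le _ _).trans (Nat.add_le_add ?_ ?_)
  · refine Finset.card_image_le.trans ?_
    simp; omega
  · refine Finset.card_image_le.trans ((Finset.card_filter_le _ _).trans ?_)
    simp only [Finset.card_univ, Fintype.card_prod, Fintype.card_fin]
    have h1 : m + 1 ≤ N := hm
    calc (m + 1) * ((m + 1) * m) ≤ N * (N * N) := by gcongr
      _ = N ^ 3 := by ring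

open Classical in
/-- All lines used. -/
noncomputable def lineFam (N : ℕ) : Finset (BFunc N) :=
  (Finset.range N).biUnion fun m =>
    (Finset.univ : Finset (Fin N → Fin (m + 1) × Fin m)).biUnion fun r =>
      (Finset.range (N + N ^ 3)).image fun k => orL ((psi m N r).toList.drop k)

lemma lineFam_card (N : ℕ) : (lineFam N).card ≤ N * ((N * N) ^ N * (N + N ^ 3)) := by
  classical
  unfold lineFam
  have h := Finset.card_biUnion_le_card_mul (Finset.range N) (fun m =>
    (Finset.univ : Finset (Fin N → Fin (m + 1) × Fin m)).biUnion fun r =>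
      (Finset.range (N + N ^ 3)).image fun k => orL ((psi m N r).toList.drop k))
    ((N * N) ^ N * (N + N ^ 3)) ?_
  · simpa using h
  · intro m hm
    have hm' : m + 1 ≤ N := Finset.mem_range.1 hm
    refine (Finset.card_biUnion_le_card_mul _ _ (N + N ^ 3) ?_).trans ?_
    · intro r _
      exact Finset.card_image_le.trans (by simp)
    · simp only [Finset.card_univ, Fintype.card_fun, Fintype.card_prod, Fintype.card_fin]
      have : m ≤ N := by omega
      gcongr

lemma lineFam_card_pow (N : ℕ) : (lineFam N).card ≤ N ^ (5 * N) := by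
  classical
  rcases Nat.lt_or_ge N 2 with h | h
  · interval_cases N
    · simp [lineFam]
    · simp [lineFam]
  · refine (lineFam_card N).trans ?_
    have h3 : N + N ^ 3 ≤ N ^ 5 := by
      have : N ^ 3 * 4 ≤ N ^ 5 := by
        calc N ^ 3 * 4 = N ^ 3 * 2 ^ 2 := by norm_num
          _ ≤ N ^ 3 * N ^ 2 := by gcongr
          _ = N ^ 5 := by ring
      have : N ≤ N ^ 3 := Nat.le_self_pow (by norm_num) N
      omega
    calc N * ((N * N) ^ N * (N + N ^ 3)) ≤ N * ((N * N) ^ N * N ^ 5) := by gcongr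
      _ = N ^ (2 * N + 6) := by rw [← pow_two, ← pow_mul]; ring
      _ ≤ N ^ (5 * N) := Nat.pow_le_pow_right (by omega) (by omega)



/-- Proposition 3.8: the family of graph pigeonhole principle formulas
is simple: there is a sequence `F = (F_n)` with `|F_n| ≤ 2^{O(n log n)}` such that every
graph pigeonhole formula over `n` variables has a tree-like `sem(F)` refutation of
length polynomial in its number of clauses. -/
theorem php_is_simple :
    ∃ F : (n : ℕ) → Set (BFunc n), ∃ C c₂ : ℝ, 0 < c₂ ∧
      (∀ n : ℕ, ((F n).ncard : ℝ) ≤ (2 : ℝ) ^ (C * n * Real.logb 2 n)) ∧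
      ∀ (m N : ℕ) (E : Finset (Fin (m + 1) × Fin m))
        (idx : {e : Fin (m + 1) × Fin m // e ∈ E} → Fin N),
        N = E.card → Function.Bijective idx →
        ∃ π : SemProof N, IsRefutation (F N) (phpCNF m N E idx) π ∧
          (π.length : ℝ) ≤ c₂ * (((phpCNF m N E idx).card : ℝ) + 1) ^ c₂ := by
  classical
  refine ⟨fun n => (lineFam n : Set (BFunc n)), 5, 2, by norm_num, ?_, ?_⟩
  · intro n
    rw [Set.ncard_coe_finset]
    have h : ((lineFam n).card : ℝ) ≤ (n : ℝ) ^ (5 * n) := by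
      exact_mod_cast lineFam_card_pow n
    refine h.trans ?_
    rcases Nat.eq_zero_or_pos n with rfl | hn
    · simp
    · have hn' : (0 : ℝ) < n := by exact_mod_cast hn
      rw [mul_comm (5 * (n : ℝ)), Real.rpow_mul (by norm_num), Real.rpow_logb (by norm_num) (by norm_num) hn',
        ← Real.rpow_natCast]
      push_cast
      exact le_rfl
  · intro m N E idx _ hbij
    have hnum : ∀ (l k : ℕ), l ≤ 2 * (k + 1) → (l : ℝ) ≤ 2 * ((k : ℝ) + 1) ^ (2 : ℝ) := by
      intro l k h
      have h1 : (l : ℝ) ≤ 2 * ((k : ℝ) + 1) := by exact_mod_cast h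
      have h2 : (0 : ℝ) ≤ k := Nat.cast_nonneg k
      rw [Real.rpow_two]
      nlinarith
    obtain ⟨e, rfl⟩ : ∃ e : {e : Fin (m + 1) × Fin m // e ∈ E} ≃ Fin N, ⇑e = idx :=
      ⟨Equiv.ofBijective idx hbij, rfl⟩
    rw [php_eq_psi]
    set r : Fin N → Fin (m + 1) × Fin m := fun v => (e.symm v : Fin (m + 1) × Fin m) with hrdef
    have hr : Function.Injective r := Subtype.val_injective.comp e.symm.injective
    by_cases hiso : ∃ p : Fin (m + 1), ∀ v, (r v).1 ≠ p
    · obtain ⟨p, hp⟩ := hiso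
      refine ⟨.leaf (falsInd (fun v => if (r v).1 = p then some true else none)),
        ⟨⟨_, ?_, rfl⟩, ?_⟩, hnum _ _ ?_⟩
      · unfold psi
        exact Finset.mem_union_left _ (Finset.mem_image.2 ⟨p, Finset.mem_univ _, rfl⟩)
      · intro α
        simp [SemProof.root, falsInd, hp]
      · simp only [SemProof.length]; omega
    · push Not at hiso
      choose v hv using hiso
      have hm : m < N := by
        have hinj : Function.Injective v := fun a b hab => by rw [← hv a, ← hv b, hab]
        have := Fintype.card_le_of_injective v hinj
        simpa using this
      have hne : (psi m N r).toList ≠ [] := by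
        intro h
        obtain ⟨c, hc, _⟩ := psi_unsat m N r hr (fun _ => true)
        rw [Finset.toList_eq_nil] at h
        simp [h] at hc
      obtain ⟨π, h1, h2, h3⟩ := exists_orL_proof (lineFam N : Set (BFunc N)) (psi m N r)
        (psi m N r).toList hne (fun c hc => Finset.mem_toList.1 hc) (by
          intro k hk
          rw [Finset.length_toList] at hk
          have := psi_card m N hm r
          simp only [lineFam, Finset.mem_coe, Finset.mem_biUnion, Finset.mem_image,
            Finset.mem_range, Finset.mem_univ, true_and]
          exact ⟨m, hm, r, k, by omega, rfl⟩)
      refine ⟨π, ⟨h1, ?_⟩, hnum _ _ ?_⟩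
      · intro α
        obtain ⟨c, hc, hcα⟩ := psi_unsat m N r hr α
        rw [h2]
        simp only [orL, List.any_eq_true]
        exact ⟨c, Finset.mem_toList.2 hc, hcα⟩
      · rw [Finset.length_toList] at h3
        omega
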